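/- Fix 1 ≤ j ≤ n and suppose f = ∑_{m=j}^{n} ∑_{0 ≤ b_1 < ⋯ < b_j = m−1} M_{m;b_1,…,b_j} · g_{b_1,…,b_j} in S(V)⊗Λ(V), where the g_{b_1,…,b_j} ∈ F_q[x_1,…,x_n]. Then f = 0 if and only if all g_{b_1,…,b_j} = 0; that is, the family of elements M_{m;b_1,…,b_j} with j ≤ m ≤ n and 0 ≤ b_1 < ⋯ < b_j = m−1 is linearly independent over the polynomial ring F_q[x_1,…,x_n]. -/

import Mathlib

open scoped TensorProduct
open MvPolynomial Finset

noncomputable section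

/-- The symmetric algebra `S(V) = F[x_1,…,x_n]` of the natural module `V = F^n`. -/
abbrev SV (F : Type) [Field F] (n : ℕ) := MvPolynomial (Fin n) F

/-- The exterior algebra `Λ(V) = E[y_1,…,y_n]`. -/
abbrev LV (F : Type) [Field F] (n : ℕ) := ExteriorAlgebra F (Fin n → F)

/-- `S(V) ⊗ Λ(V)`. -/
abbrev SL (F : Type) [Field F] (n : ℕ) := SV F n ⊗[F] LV F n

/-- the variable `x_{a+1}` (0-indexed `a`), junk value `0` out of range. -/
def xV (F : Type) [Field F] (n a : ℕ) : SV F n :=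
  if h : a < n then X ⟨a, h⟩ else 0

/-- the exterior generator `y_{a+1}` (0-indexed `a`). -/
def yV (F : Type) [Field F] (n a : ℕ) : LV F n :=
  if h : a < n then ExteriorAlgebra.ι F (Pi.single (⟨a, h⟩ : Fin n) (1 : F)) else 0

/-- the product `y_{s_1} ⋯ y_{s_j}` over `S = {s_1 < ⋯ < s_j}` in increasing order. -/
def yProd (F : Type) [Field F] (n : ℕ) (S : Finset ℕ) : LV F n :=
  ((S.sort (· ≤ ·)).map (yV F n)).prod

/-- determinant of the matrix `(x_t^{q^c})` with rows indexed by `c ∈ R` in increasing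
order and columns by `t ∈ C` in increasing order; junk value `0` if sizes differ. -/
def subDet (F : Type) [Field F] (q n : ℕ) (R C : Finset ℕ) : SV F n :=
  if h : C.card = R.card then
    Matrix.det (Matrix.of fun i j : Fin R.card =>
      xV F n (C.orderEmbOfFin h j) ^ q ^ (R.orderEmbOfFin rfl i : ℕ))
  else 0

/-- Mui's element `M_{m;b_1,…,b_j}` where `B = {b_1 < ⋯ < b_j}` (0-indexed `b`'s);
for `B = ∅` this is the Moore determinant `det (x_t^{q^c})`. -/
def MuiM (F : Type) [Field F] (q n m : ℕ) (B : Finset ℕ) : SL F n :=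
  ∑ S ∈ (range m).powersetCard B.card,
    ((-1 : F) ^ (B.card * (B.card + 1) / 2 + (∑ s ∈ S, s) + B.card)) •
      (subDet F q n (range m \ B) (range m \ S) ⊗ₜ[F] yProd F n S)

/-- `∏_{c : F^a} (c_1 x_1 + ⋯ + c_a x_a + x_{t+1})` (0-indexed `t`). -/
def linProd (F : Type) [Field F] [Fintype F] (n a t : ℕ) : SV F n :=
  ∏ c : Fin a → F, ((∑ k : Fin a, MvPolynomial.C (c k) * xV F n k) + xV F n t)

/-- Dickson's `L_m = V_1 V_2 ⋯ V_m`. -/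
def Lm (F : Type) [Field F] [Fintype F] (n m : ℕ) : SV F n :=
  ∏ a ∈ range m, linProd F n a a

/-- The property characterizing the Dickson invariants `Q_{m,k}`:
`Q_{m,k} · L_m = L_{m,k}` in `F[x_1,…,x_m]`. -/
def DicksonProp (F : Type) [Field F] [Fintype F] (q : ℕ)
    (Q : (m : ℕ) → ℕ → SV F m) : Prop :=
  ∀ m k : ℕ, k ≤ m →
    Q m k * Lm F m m = subDet F q m (range (m + 1) \ {k}) (range m)

/-- action of a matrix on `S(V)` by linear substitution: `x_j ↦ ∑_i g_{ij} x_i`. -/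
def gAct (F : Type) [Field F] (n : ℕ) (g : Matrix (Fin n) (Fin n) F) :
    SV F n →ₐ[F] SV F n :=
  MvPolynomial.aeval fun j => ∑ i, MvPolynomial.C (g i j) * MvPolynomial.X i

/-- action of a matrix on `Λ(V)` by linear substitution: `y_j ↦ ∑_i g_{ij} y_i`. -/
def eAct (F : Type) [Field F] (n : ℕ) (g : Matrix (Fin n) (Fin n) F) :
    LV F n →ₐ[F] LV F n :=
  ExteriorAlgebra.map g.mulVecLin

/-- diagonal action of a matrix on `S(V) ⊗ Λ(V)`. -/
def tAct (F : Type) [Field F] (n : ℕ) (g : Matrix (Fin n) (Fin n) F) :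
    SL F n →ₐ[F] SL F n :=
  Algebra.TensorProduct.map (gAct F n g) (eAct F n g)

/-- the invariants of a set of matrices on `S(V) ⊗ Λ(V)`, as an `F`-subspace. -/
def invSL (F : Type) [Field F] (n : ℕ) (P : Set (Matrix (Fin n) (Fin n) F)) :
    Submodule F (SL F n) where
  carrier := {f | ∀ g ∈ P, tAct F n g f = f}
  add_mem' := fun ha hb g hg => by rw [map_add, ha g hg, hb g hg]
  zero_mem' := fun g hg => map_zero _
  smul_mem' := fun c f hf g hg => by rw [map_smul, hf g hg]

/-- the invariants of `S(V) ⊗ Λ(V) ⊗ Det^k`, i.e. elements with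
`det(g)^k (g·f) = f` for all `g ∈ P`. -/
def invSLtw (F : Type) [Field F] (n k : ℕ) (P : Set (Matrix (Fin n) (Fin n) F)) :
    Submodule F (SL F n) where
  carrier := {f | ∀ g ∈ P, g.det ^ k • tAct F n g f = f}
  add_mem' := fun ha hb g hg => by rw [map_add, smul_add, ha g hg, hb g hg]
  zero_mem' := fun g hg => by rw [map_zero, smul_zero]
  smul_mem' := fun c f hf g hg => by rw [map_smul, smul_comm, hf g hg]

/-- the invariants of a set of matrices on `S(V)`, as an `F`-subalgebra. -/
def invS (F : Type) [Field F] (n : ℕ) (P : Set (Matrix (Fin n) (Fin n) F)) :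
    Subalgebra F (SV F n) where
  carrier := {f | ∀ g ∈ P, gAct F n g f = f}
  mul_mem' := fun ha hb g hg => by rw [map_mul, ha g hg, hb g hg]
  one_mem' := fun g hg => map_one _
  add_mem' := fun ha hb g hg => by rw [map_add, ha g hg, hb g hg]
  zero_mem' := fun g hg => map_zero _
  algebraMap_mem' := fun c g hg => (gAct F n g).commutes c

/-- `v_{i,j+1}` (0-indexed `j`) for the composition `I`. -/
def vij (F : Type) [Field F] [Fintype F] (n : ℕ) (I : Composition n)
    (i : Fin I.length) (j : ℕ) : SV F n :=
  linProd F n (I.sizeUpTo i) (I.sizeUpTo i + j)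

/-- `θ_i = L_{n_i}(v_{i,1},…,v_{i,n_i})`. -/
def theta (F : Type) [Field F] [Fintype F] (n : ℕ) (I : Composition n)
    (i : Fin I.length) : SV F n :=
  MvPolynomial.aeval (fun t : Fin (I.blocksFun i) => vij F n I i t)
    (Lm F (I.blocksFun i) (I.blocksFun i))

/-- `q_{i,k} = Q_{n_i,k}(v_{i,1},…,v_{i,n_i})`, given the Dickson polynomials `Q`. -/
def qInv (F : Type) [Field F] [Fintype F] (n : ℕ) (Q : (m : ℕ) → ℕ → SV F m)
    (I : Composition n) (i : Fin I.length) (k : ℕ) : SV F n :=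
  MvPolynomial.aeval (fun t : Fin (I.blocksFun i) => vij F n I i t)
    (Q (I.blocksFun i) k)

/-- the index of the block (0-indexed) of the composition `I` containing `a`. -/
def blkIdx (n : ℕ) (I : Composition n) (a : ℕ) : ℕ :=
  ((range I.length).filter fun i => I.sizeUpTo (i + 1) ≤ a).card

/-- the parabolic subgroup `P_I`: invertible block upper-triangular matrices. -/
def PIset (F : Type) [Field F] (n : ℕ) (I : Composition n) :
    Set (Matrix (Fin n) (Fin n) F) :=
  {g | IsUnit g.det ∧ ∀ a b : Fin n, blkIdx n I b < blkIdx n I a → g a b = 0}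

/-- the subgroup `K_I ≤ P_I`: block upper-triangular with all diagonal blocks
of determinant `1`. -/
def KIset (F : Type) [Field F] (n : ℕ) (I : Composition n) :
    Set (Matrix (Fin n) (Fin n) F) :=
  {g | IsUnit g.det ∧ (∀ a b : Fin n, blkIdx n I b < blkIdx n I a → g a b = 0) ∧
    ∀ i : Fin I.length,
      Matrix.det (Matrix.of fun a b : Fin (I.blocksFun i) =>
        g (I.embedding i a) (I.embedding i b)) = 1}

/-- the unipotent subgroup `U_n` of uni-uppertriangular matrices. -/
def Uset (F : Type) [Field F] (n : ℕ) : Set (Matrix (Fin n) (Fin n) F) :=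
  {g | (∀ a b : Fin n, b < a → g a b = 0) ∧ ∀ a : Fin n, g a a = 1}

/-- `SL_n(q)`. -/
def SLset (F : Type) [Field F] (n : ℕ) : Set (Matrix (Fin n) (Fin n) F) :=
  {g | g.det = 1}

/-- `GL_n(q)`. -/
def GLset (F : Type) [Field F] (n : ℕ) : Set (Matrix (Fin n) (Fin n) F) :=
  {g | IsUnit g.det}

/-- the bigraded piece `S^i(V) ⊗ Λ^j(V)` of `S(V) ⊗ Λ(V)`. -/
def piece (F : Type) [Field F] (n i j : ℕ) : Submodule F (SL F n) :=
  LinearMap.range (TensorProduct.map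
    (MvPolynomial.homogeneousSubmodule (Fin n) F i).subtype
    (LinearMap.range (ExteriorAlgebra.ι F (M := Fin n → F)) ^ j).subtype)

/-- the Hilbert series in `ℤ[s][[t]]` of a bigraded subspace `W` of `S(V) ⊗ Λ(V)`:
the coefficient of `t^i` is `∑_{j=0}^n dim (W ∩ (S^i ⊗ Λ^j)) s^j`. -/
def Hser (F : Type) [Field F] (n : ℕ) (W : Submodule F (SL F n)) :
    PowerSeries (Polynomial ℤ) :=
  PowerSeries.mk fun i => ∑ j ∈ range (n + 1),
    Polynomial.C (Module.finrank F ↥(W ⊓ piece F n i j) : ℤ) * Polynomial.X ^ j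

/-- the Hilbert series in `ℤ[[t]]` of a graded subalgebra of `S(V)`. -/
def HserS (F : Type) [Field F] (n : ℕ) (W : Subalgebra F (SV F n)) :
    PowerSeries ℤ :=
  PowerSeries.mk fun d =>
    (Module.finrank F ↥(Subalgebra.toSubmodule W ⊓ MvPolynomial.homogeneousSubmodule (Fin n) F d) : ℤ)

/-- the index set for Mui-type basis elements attached to the composition `I`:
pairs `(i, B)` with `B = {b_1 < ⋯ < b_j} ⊆ {0,…,m_{i+1}−1}` nonempty and
`max B ≥ m_i` (0-indexed `i`). -/
def Adm (n : ℕ) (I : Composition n) : Finset (Fin I.length × Finset ℕ) :=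
  (Finset.univ ×ˢ (range n).powerset).filter fun x =>
    x.2 ⊆ range (I.sizeUpTo ((x.1 : ℕ) + 1)) ∧ x.2.Nonempty ∧ ∃ b ∈ x.2, I.sizeUpTo (x.1 : ℕ) ≤ b

/-- The minors of size `k` of a square matrix with independent rows form a matrix with
independent rows. -/
theorem eq_zero_of_sum_mul_minor_eq_zero {K I : Type*} [Field K] [Fintype I] [LinearOrder I]
    (k : ℕ) {w : I → I → K} (hw : LinearIndependent K w)
    (h : Set.powersetCard I k → K)
    (H : ∀ C : Set.powersetCard I k, ∑ R : Set.powersetCard I k,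
      h R * Matrix.det (Matrix.of fun i j : Fin k =>
        w (R.1.orderEmbOfFin R.2 i) (C.1.orderEmbOfFin C.2 j)) = 0)
    (R : Set.powersetCard I k) : h R = 0 := by
  have hli := exteriorPower.ιMulti_family_linearIndependent_field (K := K) k hw
  refine Fintype.linearIndependent_iff.1 hli h ?_ R
  apply ((Pi.basisFun K I).exteriorPower k).ext_elem
  intro C
  rw [exteriorPower.basis_repr_apply, map_sum, map_zero, Finsupp.zero_apply, ← H C]
  refine Finset.sum_congr rfl fun R _ => ?_
  rw [map_smul, exteriorPower.ιMulti_family, exteriorPower.ιMultiDual_apply_ιMulti, smul_eq_mul]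
  rfl

theorem linearIndependent_algebraMap_moore (F : Type) [Field F] {q n N : ℕ} (hq : 1 < q)
    (hN : N ≤ n) :
    LinearIndependent (FractionRing (SV F n)) (fun c t : Fin N =>
      algebraMap (SV F n) (FractionRing (SV F n)) (xV F n t ^ q ^ (c : ℕ))) := by
  set A : Matrix (Fin N) (Fin N) (SV F n) := Matrix.of fun c t => xV F n t ^ q ^ (c : ℕ) with hA
  have hdet : A.det ≠ 0 := by
    let e (σ : Equiv.Perm (Fin N)) : Fin n →₀ ℕ :=
      ∑ t : Fin N, Finsupp.single (Fin.castLE hN t) (q ^ (σ t : ℕ))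
    have hprod (σ : Equiv.Perm (Fin N)) : ∏ t, A (σ t) t = monomial (e σ) 1 := by
      simp only [e, monomial_sum_one]
      refine Finset.prod_congr rfl fun t _ => ?_
      have ht : (t : ℕ) < n := t.2.trans_le hN
      simp only [hA, Matrix.of_apply, xV, dif_pos ht, X_pow_eq_monomial]
      rfl
    have he (σ : Equiv.Perm (Fin N)) (h : e σ = e 1) : σ = 1 := by
      ext t
      have h1 := DFunLike.congr_fun h (Fin.castLE hN t)
      simp only [e, Finsupp.finsetSum_apply, Finsupp.single_apply,
        Fin.castLE_inj, Finset.sum_ite_eq', Finset.mem_univ, if_true] at h1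
      exact Nat.pow_right_injective hq h1
    have hcoeff : coeff (e 1) A.det = 1 := by
      rw [Matrix.det_apply, coeff_sum, Finset.sum_eq_single 1]
      · rw [hprod, Equiv.Perm.sign_one, one_smul, coeff_monomial, if_pos rfl]
      · intro σ _ hσ
        rw [hprod, Units.smul_def, coeff_smul, coeff_monomial, if_neg fun h => hσ (he σ h),
          smul_zero]
      · simp
    intro h
    simp [h] at hcoeff
  have := Matrix.linearIndependent_rows_of_det_ne_zero
    (A := A.map (algebraMap (SV F n) (FractionRing (SV F n)))) (by
      rw [← RingHom.mapMatrix_apply, ← RingHom.map_det]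
      exact fun h => hdet ((IsFractionRing.injective (SV F n) (FractionRing (SV F n)))
        (h.trans (map_zero _).symm)))
  exact this

theorem subDet_eq_det (F : Type) [Field F] {q n k : ℕ} {R C : Finset ℕ}
    (hR : R.card = k) (hC : C.card = k) :
    subDet F q n R C = Matrix.det (Matrix.of fun i j : Fin k =>
      xV F n (C.orderEmbOfFin hC j) ^ q ^ (R.orderEmbOfFin hR i : ℕ)) := by
  subst hR
  rw [subDet, dif_pos hC]

theorem orderEmbOfFin_map_val {N k : ℕ} {C : Finset (Fin N)} (hC : C.card = k)
    (hC' : (C.map Fin.valEmbedding).card = k) (i : Fin k) :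
    (C.map Fin.valEmbedding).orderEmbOfFin hC' i = (C.orderEmbOfFin hC i : ℕ) := by
  have := Finset.orderEmbOfFin_unique hC' (f := fun i => (C.orderEmbOfFin hC i : ℕ))
    (fun i => Finset.mem_map_of_mem Fin.valEmbedding (Finset.orderEmbOfFin_mem C hC i))
    (fun a b hab => (C.orderEmbOfFin hC).strictMono hab)
  exact (congrFun this i).symm

theorem exists_map_val_eq {N : ℕ} {S : Finset ℕ} (hS : S ⊆ range N) :
    ∃ T : Finset (Fin N), T.map Fin.valEmbedding = S := by
  refine ⟨Finset.univ.filter fun t : Fin N => (t : ℕ) ∈ S, ?_⟩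
  ext a
  simp only [Finset.mem_map, Finset.mem_filter, Finset.mem_univ, true_and, Fin.valEmbedding_apply]
  exact ⟨fun ⟨t, ht, h⟩ => h ▸ ht, fun ha => ⟨⟨a, Finset.mem_range.1 (hS ha)⟩, ha, rfl⟩⟩

theorem map_val_mem_powersetCard {N k : ℕ} (T : Set.powersetCard (Fin N) k) :
    T.1.map Fin.valEmbedding ∈ (range N).powersetCard k := by
  rw [Finset.mem_powersetCard, Finset.card_map]
  refine ⟨fun a ha => ?_, T.2⟩
  obtain ⟨t, _, rfl⟩ := Finset.mem_map.1 ha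
  exact Finset.mem_range.2 t.2

theorem eq_zero_of_sum_mul_subDet_eq_zero (F : Type) [Field F] {q n N k : ℕ} (hq : 1 < q)
    (hN : N ≤ n) (h : Finset ℕ → SV F n)
    (H : ∀ C ∈ (range N).powersetCard k,
      ∑ R ∈ (range N).powersetCard k, h R * subDet F q n R C = 0) :
    ∀ R ∈ (range N).powersetCard k, h R = 0 := by
  let φ := algebraMap (SV F n) (FractionRing (SV F n))
  have hφ : Function.Injective φ := IsFractionRing.injective _ _
  intro R hR
  obtain ⟨R, rfl⟩ := exists_map_val_eq (Finset.mem_powersetCard.1 hR).1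
  have hRk : R.card = k := by simpa using (Finset.mem_powersetCard.1 hR).2
  apply hφ
  rw [map_zero]
  refine eq_zero_of_sum_mul_minor_eq_zero k (linearIndependent_algebraMap_moore F hq hN)
    (fun R => φ (h (R.1.map Fin.valEmbedding))) (fun C => ?_) ⟨R, hRk⟩
  rw [← map_zero φ, ← H _ (map_val_mem_powersetCard C), map_sum]
  refine Finset.sum_bij (fun R _ => R.1.map Fin.valEmbedding)
    (fun R _ => map_val_mem_powersetCard R)
    (fun R _ R' _ e => Subtype.ext (Finset.map_injective _ e)) (fun S hS => ?_) (fun R _ => ?_)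
  · obtain ⟨T, rfl⟩ := exists_map_val_eq (Finset.mem_powersetCard.1 hS).1
    exact ⟨⟨T, by simpa using (Finset.mem_powersetCard.1 hS).2⟩, Finset.mem_univ _, rfl⟩
  · have hR' := (Finset.mem_powersetCard.1 (map_val_mem_powersetCard R)).2
    have hC' := (Finset.mem_powersetCard.1 (map_val_mem_powersetCard C)).2
    rw [map_mul, subDet_eq_det F hR' hC', RingHom.map_det]
    congr 2
    ext i j
    simp only [RingHom.mapMatrix_apply, Matrix.map_apply, Matrix.of_apply,
      orderEmbOfFin_map_val R.2, orderEmbOfFin_map_val C.2]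
    rfl

theorem yProd_map_val (F : Type) [Field F] (n : ℕ) (S : Finset (Fin n)) :
    yProd F n (S.map Fin.valEmbedding) = (Pi.basisFun F (Fin n)).ExteriorAlgebra S := by
  rw [ExteriorAlgebra.basis_apply_ofCard _ rfl, ExteriorAlgebra.ιMulti_family,
    ExteriorAlgebra.ιMulti_apply, yProd, ← Finset.listMap_orderEmbOfFin_finRange _
      (Finset.card_map Fin.valEmbedding), List.map_map, List.ofFn_eq_map]
  congr 1
  refine List.map_congr_left fun i _ => ?_
  rw [Function.comp_apply, orderEmbOfFin_map_val rfl, yV, dif_pos (Fin.is_lt _)]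
  simp [Set.powersetCard.ofFinEmbEquiv_symm_apply]

/-- The `SV F n`-basis of `SL F n` given by the products of the exterior generators. -/
def basisSL (F : Type) [Field F] (n : ℕ) : Module.Basis (Finset (Fin n)) (SV F n) (SL F n) :=
  Algebra.TensorProduct.basis (SV F n) (Pi.basisFun F (Fin n)).ExteriorAlgebra

theorem basisSL_coord_tmul_yProd (F : Type) [Field F] {n : ℕ} (a : SV F n) {S T : Finset (Fin n)} :
    (basisSL F n).coord S (a ⊗ₜ yProd F n (T.map Fin.valEmbedding)) = if T = S then a else 0 := by
  classical
  rw [yProd_map_val, Module.Basis.coord_apply, basisSL, Algebra.TensorProduct.basis_repr_tmul,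
    Module.Basis.repr_self]
  simp [Finsupp.single_apply]

theorem basisSL_coord_mul_MuiM (F : Type) [Field F] {q n m : ℕ} (hm : m ≤ n) (a : SV F n)
    (B : Finset ℕ) (S : Finset (Fin n)) :
    (basisSL F n).coord S ((a ⊗ₜ[F] (1 : LV F n)) * MuiM F q n m B) =
      if S.map Fin.valEmbedding ∈ (range m).powersetCard B.card then
        ((-1 : F) ^ (B.card * (B.card + 1) / 2 + (∑ s ∈ S.map Fin.valEmbedding, s) + B.card)) •
          (a * subDet F q n (range m \ B) (range m \ S.map Fin.valEmbedding))
      else 0 := by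
  rw [MuiM, Finset.mul_sum, map_sum, ← Finset.sum_ite_eq' ((range m).powersetCard B.card)
    (S.map Fin.valEmbedding) (fun T => ((-1 : F) ^ (B.card * (B.card + 1) / 2 + (∑ s ∈ T, s) +
      B.card)) • (a * subDet F q n (range m \ B) (range m \ T)))]
  refine Finset.sum_congr rfl fun T hT => ?_
  obtain ⟨T, rfl⟩ := exists_map_val_eq
    ((Finset.mem_powersetCard.1 hT).1.trans (Finset.range_subset_range.2 hm))
  rw [mul_smul_comm, Algebra.TensorProduct.tmul_mul_tmul, one_mul, TensorProduct.smul_tmul',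
    basisSL_coord_tmul_yProd]
  simp only [Finset.map_inj]

/-- **Lemma 2.4** (Mui, Lemma 5.2). The elements `M_{m;b_1,…,b_j}` with
`j ≤ m ≤ n` and `0 ≤ b_1 < ⋯ < b_j = m−1` are linearly independent over
`F_q[x_1,…,x_n]`. -/
theorem mui_linear_independence
    (F : Type) [Field F] [Fintype F] (p r q n j : ℕ)
    (hp : p.Prime) (hr : 0 < r) (hq : q = p ^ r) (hF : Fintype.card F = q)
    (hj : 1 ≤ j) (hjn : j ≤ n)
    (g : ℕ → Finset ℕ → SV F n) :
    (∑ m ∈ Finset.Icc j n,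
        ∑ B ∈ ((range m).powersetCard j).filter (fun B => m - 1 ∈ B),
          (g m B ⊗ₜ[F] (1 : LV F n)) * MuiM F q n m B) = 0
    ↔ ∀ m ∈ Finset.Icc j n,
        ∀ B ∈ ((range m).powersetCard j).filter (fun B => m - 1 ∈ B),
          g m B = 0 := by
  have hq1 : 1 < q := hF ▸ Fintype.one_lt_card
  refine ⟨fun h0 m => ?_, fun h => Finset.sum_eq_zero fun m hm => Finset.sum_eq_zero fun B hB => by
    rw [h m hm B hB, TensorProduct.zero_tmul, zero_mul]⟩
  induction hd : n - m using Nat.strong_induction_on generalizing m with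
  | _ d ih =>
  intro hm
  obtain ⟨hjm, hmn⟩ := Finset.mem_Icc.1 hm
  have hsub : range (m - 1) ⊆ range m := Finset.range_subset_range.2 (Nat.sub_le m 1)
  have hcompl' {B : Finset ℕ} (hB : B ∈ ((range m).powersetCard j).filter (fun B => m - 1 ∈ B)) :
      range m \ B ∈ (range (m - 1)).powersetCard (m - j) := by
    obtain ⟨hB, hmB⟩ := Finset.mem_filter.1 hB
    obtain ⟨hBm, hBj⟩ := Finset.mem_powersetCard.1 hB
    refine Finset.mem_powersetCard.2 ⟨fun a ha => ?_, ?_⟩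
    · obtain ⟨ha, haB⟩ := Finset.mem_sdiff.1 ha
      have : a ≠ m - 1 := fun h => haB (h ▸ hmB)
      simp only [Finset.mem_range] at ha ⊢
      omega
    · rw [Finset.card_sdiff_of_subset hBm, Finset.card_range, hBj]
  have key := eq_zero_of_sum_mul_subDet_eq_zero F (k := m - j) hq1 ((Nat.sub_le m 1).trans hmn)
    (fun R => g m (range m \ R)) ?_
  · intro B hB
    have hBm := (Finset.mem_powersetCard.1 (Finset.mem_filter.1 hB).1).1
    simpa only [Finset.sdiff_sdiff_eq_self hBm] using key (range m \ B) (hcompl' hB)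
  intro C hC
  obtain ⟨hCN, hCk⟩ := Finset.mem_powersetCard.1 hC
  have hCm : C ⊆ range m := hCN.trans hsub
  have hcompl {R : Finset ℕ} (hR : R ∈ (range (m - 1)).powersetCard (m - j)) :
      range m \ R ∈ ((range m).powersetCard j).filter (fun B => m - 1 ∈ B) := by
    obtain ⟨hRN, hRk⟩ := Finset.mem_powersetCard.1 hR
    refine Finset.mem_filter.2 ⟨Finset.mem_powersetCard.2 ⟨Finset.sdiff_subset, ?_⟩,
      Finset.mem_sdiff.2 ⟨Finset.mem_range.2 (by omega), fun h => ?_⟩⟩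
    · rw [Finset.card_sdiff_of_subset (hRN.trans hsub), Finset.card_range, hRk]
      omega
    · exact absurd (Finset.mem_range.1 (hRN h)) (lt_irrefl _)
  obtain ⟨hS, hmS⟩ := Finset.mem_filter.1 (hcompl hC)
  obtain ⟨T, hT⟩ := exists_map_val_eq (N := n)
    ((Finset.mem_powersetCard.1 hS).1.trans (Finset.range_subset_range.2 hmn))
  have h1 := congrArg ((basisSL F n).coord T) h0
  rw [map_zero, map_sum, Finset.sum_eq_single_of_mem m hm, map_sum] at h1
  · have h2 : ∑ B ∈ ((range m).powersetCard j).filter (fun B => m - 1 ∈ B),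
        ((-1 : F) ^ (j * (j + 1) / 2 + (∑ s ∈ range m \ C, s) + j)) •
          (g m B * subDet F q n (range m \ B) C) = 0 := by
      rw [← h1]
      refine Finset.sum_congr rfl fun B hB => ?_
      have hBj := (Finset.mem_powersetCard.1 (Finset.mem_filter.1 hB).1).2
      rw [basisSL_coord_mul_MuiM F hmn, hT, hBj, if_pos hS, Finset.sdiff_sdiff_eq_self hCm]
    rw [← Finset.smul_sum, smul_eq_zero_iff_right (pow_ne_zero _ (neg_ne_zero.2 one_ne_zero))] at h2
    rw [← h2]
    refine Finset.sum_bij' (fun R _ => range m \ R) (fun B _ => range m \ B)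
      (fun R hR => hcompl hR) (fun B hB => hcompl' hB) (fun R hR => ?_) (fun B hB => ?_) (fun R hR => ?_)
    · exact Finset.sdiff_sdiff_eq_self ((Finset.mem_powersetCard.1 hR).1.trans hsub)
    · exact Finset.sdiff_sdiff_eq_self
        (Finset.mem_powersetCard.1 (Finset.mem_filter.1 hB).1).1
    · rw [Finset.sdiff_sdiff_eq_self ((Finset.mem_powersetCard.1 hR).1.trans hsub)]
  · intro m' hm' hne
    obtain ⟨hjm', hmn'⟩ := Finset.mem_Icc.1 hm'
    rw [map_sum]
    refine Finset.sum_eq_zero fun B hB => ?_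
    rcases lt_or_gt_of_ne hne with hlt | hgt
    · rw [basisSL_coord_mul_MuiM F hmn', hT, if_neg fun h => ?_]
      have := Finset.mem_range.1 ((Finset.mem_powersetCard.1 h).1 hmS)
      omega
    · rw [ih (n - m') (by omega) m' rfl hm' B hB, TensorProduct.zero_tmul, zero_mul, map_zero]
end
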